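/- Let τ be a split Cartan involution of a semisimple Lie algebra g normalizing a Cartan subalgebra t, i.e. an involution with dim g^τ = #Φ/2. Then the set of τ-fixed roots Φ^τ spans the τ-fixed subspace t^{*,τ}, and t^τ is a Cartan subalgebra of the derived algebra of the Levi l = t ⊕ ⊕_{γ∈Φ^τ} g_γ. -/

import Mathlib

/-! STATEMENT 8: Let `τ` be a split Cartan involution of a semisimple Lie algebra `g`
normalizing a Cartan subalgebra `t = H`, i.e. an involution with `dim g^τ = #Φ/2`.  Then
the set `Φ^τ` of `τ`-fixed roots spans the `τ`-fixed subspace `t^{*,τ}` (equivalently: no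
nonzero `τ`-fixed element of `t` is annihilated by all `τ`-fixed roots), and `t^τ` is a
Cartan subalgebra of the derived algebra of the Levi `l = t ⊕ ⨁_{γ ∈ Φ^τ} g_γ`. -/

section

variable {K : Type*} [Field K] {g : Type*} [LieRing g] [LieAlgebra K g]

/-- The fixed-point subalgebra `g^τ` of an automorphism `τ` of a Lie algebra `g`. -/
def fixedLieSubalgebra (τ : g ≃ₗ⁅K⁆ g) : LieSubalgebra K g where
  carrier := {x : g | τ x = x}
  add_mem' := by
    intro a b ha hb
    simp only [Set.mem_setOf_eq] at *
    rw [show τ (a + b) = τ a + τ b from map_add τ.toLinearEquiv a b, ha, hb]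
  zero_mem' := by
    simp only [Set.mem_setOf_eq]
    exact map_zero τ.toLinearEquiv
  smul_mem' := by
    intro c x hx
    simp only [Set.mem_setOf_eq] at *
    rw [show τ (c • x) = c • τ x from map_smul τ.toLinearEquiv c x, hx]
  lie_mem' := by
    intro x y hx hy
    simp only [Set.mem_setOf_eq] at *
    rw [show τ ⁅x, y⁆ = ⁅τ x, τ y⁆ from LieHom.map_lie τ.toLieHom x y, hx, hy]

variable [FiniteDimensional K g]

/-- The Levi subalgebra `l = t ⊕ ⨁_{γ ∈ Φ^τ} g_γ` attached to the set of `τ`-fixed roots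
(since this subspace is closed under brackets, it agrees with the Lie subalgebra it
generates). -/
noncomputable def leviOfFixedRoots (H : LieSubalgebra K g) [H.IsCartanSubalgebra]
    (τ : g ≃ₗ⁅K⁆ g) (hH : ∀ x ∈ H, τ x ∈ H) : LieSubalgebra K g :=
  LieSubalgebra.lieSpan K g
    ((H : Set g) ∪
      ⋃ w : {w : LieModule.Weight K H g //
          w.IsNonZero ∧ ∀ y : ↥H, w y = w ⟨τ (y : g), hH y y.2⟩},
        ((LieAlgebra.rootSpace H ((w : LieModule.Weight K H g) : ↥H → K) :
          LieSubmodule K H g) : Set g))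

/-- The derived subalgebra of a Lie subalgebra (the subalgebra generated by brackets). -/
noncomputable def derivedOf (l : LieSubalgebra K g) : LieSubalgebra K g :=
  LieSubalgebra.lieSpan K g {x : g | ∃ a ∈ l, ∃ b ∈ l, x = ⁅a, b⁆}

end

namespace RootPairing

variable {ι K M N : Type*} [Field K] [CharZero K] [AddCommGroup M] [Module K M]
  [AddCommGroup N] [Module K N] (P : RootPairing ι K M N)

omit [CharZero K] in
lemma exists_root_eq_neg (i : ι) : ∃ j, P.root j = -P.root i :=
  ⟨P.reflectionPerm i i, by simp⟩

section pairingIn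

variable [P.IsCrystallographic]

lemma pairingIn_eq_of_root_eq_add {i j k : ι} (h : P.root k = P.root i + P.root j) (l : ι) :
    P.pairingIn ℤ k l = P.pairingIn ℤ i l + P.pairingIn ℤ j l := by
  apply FaithfulSMul.algebraMap_injective ℤ K
  simp only [map_add, algebraMap_pairingIn, ← root_coroot'_eq_pairing, h]

lemma pairingIn_eq_of_root_eq_sub {i j k : ι} (h : P.root k = P.root i - P.root j) (l : ι) :
    P.pairingIn ℤ k l = P.pairingIn ℤ i l - P.pairingIn ℤ j l := by
  apply FaithfulSMul.algebraMap_injective ℤ K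
  simp only [map_sub, algebraMap_pairingIn, ← root_coroot'_eq_pairing, h]

lemma pairingIn_eq_of_root_eq_neg {i j : ι} (h : P.root j = -P.root i) (l : ι) :
    P.pairingIn ℤ j l = -P.pairingIn ℤ i l := by
  apply FaithfulSMul.algebraMap_injective ℤ K
  simp only [map_neg, algebraMap_pairingIn, ← root_coroot'_eq_pairing, h]

lemma pairingIn_eq_iff_coroot' {i a : ι} {n : ℤ} :
    P.pairingIn ℤ i a = n ↔ P.coroot' a (P.root i) = n := by
  rw [root_coroot'_eq_pairing, ← P.algebraMap_pairingIn ℤ]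
  simp

omit [CharZero K] in
lemma root_reflectionPerm_eq_sub (a i : ι) :
    P.root (P.reflectionPerm a i) = P.root i - P.pairingIn ℤ i a • P.root a := by
  rw [root_reflectionPerm, reflection_apply_root, ← P.algebraMap_pairingIn ℤ]
  simp [Int.cast_smul_eq_zsmul]

lemma pairingIn_reflectionPerm_left (a i : ι) :
    P.pairingIn ℤ (P.reflectionPerm a i) a = -P.pairingIn ℤ i a := by
  apply FaithfulSMul.algebraMap_injective ℤ K
  rw [map_neg, algebraMap_pairingIn, algebraMap_pairingIn, ← pairing_reflectionPerm,
    pairing_reflectionPerm_self_right]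

end pairingIn

section orthogonal

variable [Finite ι] [P.IsCrystallographic] {a i j k : ι}

omit [Finite ι] in
lemma root_sub_mem_of_root_add_mem_of_orthogonal (hi : P.pairingIn ℤ i a = 0)
    (h : P.root i + P.root a ∈ Set.range P.root) : P.root i - P.root a ∈ Set.range P.root := by
  obtain ⟨m, hm⟩ := h
  refine ⟨P.reflectionPerm a m, ?_⟩
  rw [root_reflectionPerm_eq_sub, pairingIn_eq_of_root_eq_add P hm, hi, pairingIn_same, hm]
  module

omit [Finite ι] in
lemma root_add_mem_of_neg_of_orthogonal (hij : P.root j = -P.root i)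
    (hi : P.pairingIn ℤ i a = 0)
    (h : P.root i + P.root a ∈ Set.range P.root) : P.root j + P.root a ∈ Set.range P.root := by
  obtain ⟨m, hm⟩ := P.root_sub_mem_of_root_add_mem_of_orthogonal hi h
  obtain ⟨n, hn⟩ := P.exists_root_eq_neg m
  exact ⟨n, by rw [hn, hm, hij]; abel⟩

lemma root_add_mem_of_pairingIn_neg_of_orthogonal
    (hi : P.pairingIn ℤ i a = 0) (hj : P.pairingIn ℤ j a = 0)
    (hk : P.root k = P.root i + P.root j) (hij : P.pairingIn ℤ i j < 0)
    (h : P.root i + P.root a ∈ Set.range P.root) : P.root k + P.root a ∈ Set.range P.root := by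
  obtain ⟨m, hm⟩ := h
  have haj : P.pairingIn ℤ a j = 0 := P.pairingIn_eq_zero_iff.1 hj
  have h1 : P.pairingIn ℤ m j < 0 := by rw [pairingIn_eq_of_root_eq_add P hm]; omega
  have h2 : P.root m ≠ -P.root j := by
    intro h
    have h3 := P.pairingIn_eq_of_root_eq_neg h a
    rw [pairingIn_eq_of_root_eq_add P hm, pairingIn_same] at h3
    omega
  obtain ⟨n, hn⟩ := P.root_add_root_mem_of_pairingIn_neg h1 h2
  exact ⟨n, by rw [hn, hm, hk]; abel⟩

lemma root_add_mem_of_notMem_of_orthogonal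
    (hi : P.pairingIn ℤ i a = 0) (hj : P.pairingIn ℤ j a = 0)
    (hk : P.root k = P.root i + P.root j)
    (h : P.root i + P.root a ∈ Set.range P.root) (h' : P.root j + P.root a ∉ Set.range P.root) :
    P.root k + P.root a ∈ Set.range P.root := by
  rcases lt_or_ge (P.pairingIn ℤ i j) 0 with hij | hij
  · exact P.root_add_mem_of_pairingIn_neg_of_orthogonal hi hj hk hij h
  · exfalso
    obtain ⟨i', hi'⟩ := P.exists_root_eq_neg i
    have hji : 0 ≤ P.pairingIn ℤ j i := by
      by_contra! hc
      exact absurd ((P.pairingIn_lt_zero_iff ℤ).1 hc) (by omega)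
    have hki : 0 < P.pairingIn ℤ k i := by
      rw [pairingIn_eq_of_root_eq_add P hk, pairingIn_same]; omega
    have hik : 0 < P.pairingIn ℤ i k := (P.zero_lt_pairingIn_iff' ℤ).1 hki
    refine h' (P.root_add_mem_of_pairingIn_neg_of_orthogonal (i := i') (j := k) ?_ ?_ ?_ ?_ ?_)
    · rw [pairingIn_eq_of_root_eq_neg P hi', hi, neg_zero]
    · rw [pairingIn_eq_of_root_eq_add P hk, hi, hj, add_zero]
    · rw [hk, hi']; abel
    · rw [pairingIn_eq_of_root_eq_neg P hi']; omega
    · exact P.root_add_mem_of_neg_of_orthogonal hi' hi h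

variable [P.IsReduced]

lemma form_root_eq_of_orthogonal_of_add_mem (B : P.InvariantForm) {m : ι}
    (hi : P.pairingIn ℤ i a = 0) (hm : P.root m = P.root i + P.root a) :
    B.form (P.root i) (P.root i) = B.form (P.root a) (P.root a) := by
  have hia : B.form (P.root i) (P.root a) = 0 := by
    have := B.two_mul_apply_root_root i a
    rw [← P.algebraMap_pairingIn ℤ, hi] at this
    simpa using this
  have hai : B.form (P.root a) (P.root i) = 0 := by rw [← B.symm.eq]; simpa using hia
  have hma : P.pairingIn ℤ m a = 2 := by rw [pairingIn_eq_of_root_eq_add P hm, hi, pairingIn_same]; rfl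
  have h1 := B.two_mul_apply_root_root a m
  rw [← P.algebraMap_pairingIn ℤ, hm] at h1
  simp only [map_add, LinearMap.add_apply, hia, hai] at h1
  have hset := P.pairingIn_pairingIn_mem_set_of_isCrystal_of_isRed m a
  simp only [Set.mem_insert_iff, Prod.mk.injEq, Set.mem_singleton_iff, hma] at hset
  rcases (by omega : P.pairingIn ℤ a m = 1 ∨ P.pairingIn ℤ a m = 2) with ham | ham
  · rw [ham] at h1
    simp at h1
    linear_combination -h1
  · rw [ham] at h1
    simp at h1

lemma root_add_notMem_of_orthogonal
    (hi : P.pairingIn ℤ i a = 0) (hj : P.pairingIn ℤ j a = 0)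
    (hk : P.root k = P.root i + P.root j)
    (h : P.root i + P.root a ∈ Set.range P.root) (h' : P.root j + P.root a ∈ Set.range P.root) :
    P.root k + P.root a ∉ Set.range P.root := by
  rintro ⟨n, hn⟩
  obtain ⟨m, hm⟩ := h
  obtain ⟨l, hl⟩ := h'
  have := Fintype.ofFinite ι
  let B : P.InvariantForm := (P.posRootForm ℤ).toInvariantForm
  have hk' : P.pairingIn ℤ k a = 0 := by rw [pairingIn_eq_of_root_eq_add P hk, hi, hj, add_zero]
  have e1 := P.form_root_eq_of_orthogonal_of_add_mem B hi hm
  have e2 := P.form_root_eq_of_orthogonal_of_add_mem B hj hl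
  have e3 := P.form_root_eq_of_orthogonal_of_add_mem B hk' hn
  have hb := B.ne_zero a
  have symm : ∀ x y, B.form x y = B.form y x := fun x y ↦ by rw [← B.symm.eq]; simp
  have orth : ∀ {x}, P.pairingIn ℤ x a = 0 → B.form (P.root x) (P.root a) = 0 := by
    intro x hx
    have := B.two_mul_apply_root_root x a
    rw [← P.algebraMap_pairingIn ℤ, hx] at this
    simpa using this
  have h1 := B.two_mul_apply_root_root j m
  rw [← P.algebraMap_pairingIn ℤ, hm] at h1
  rw [hk] at e3
  simp only [map_add, LinearMap.add_apply, orth hi, symm (P.root a), orth hj, e1, e2,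
    symm (P.root j) (P.root i)] at h1 e3
  have h2 : ((2 * P.pairingIn ℤ j m + 1 : ℤ) : K) * B.form (P.root a) (P.root a) = 0 := by
    push_cast
    simp at h1
    linear_combination e3 - h1
  rcases mul_eq_zero.1 h2 with h | h
  · norm_cast at h; omega
  · exact hb h

lemma root_add_mem_iff_of_orthogonal
    (hi : P.pairingIn ℤ i a = 0) (hj : P.pairingIn ℤ j a = 0)
    (hk : P.root k = P.root i + P.root j) :
    P.root k + P.root a ∈ Set.range P.root ↔
      ¬(P.root i + P.root a ∈ Set.range P.root ↔ P.root j + P.root a ∈ Set.range P.root) := by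
  have h1 := P.root_add_notMem_of_orthogonal hi hj hk
  have h2 := P.root_add_mem_of_notMem_of_orthogonal hi hj hk
  have h3 := P.root_add_mem_of_notMem_of_orthogonal hj hi (hk.trans (add_comm _ _))
  obtain ⟨j', hj'⟩ := P.exists_root_eq_neg j
  have hk' : P.pairingIn ℤ k a = 0 := by rw [pairingIn_eq_of_root_eq_add P hk, hi, hj, add_zero]
  have hj0 : P.pairingIn ℤ j' a = 0 := by rw [pairingIn_eq_of_root_eq_neg P hj', hj, neg_zero]
  have h4 := P.root_add_mem_of_notMem_of_orthogonal hk' hj0 (k := i) (by rw [hk, hj']; abel)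
  have h5 := P.root_add_mem_of_neg_of_orthogonal (a := a) (i := j') (j := j)
    (by rw [hj', neg_neg]) hj0
  tauto

end orthogonal
/-- A sign function on the roots in a subspace `W` which is multiplicative
along sums of roots. -/
structure IsSignCharacterOn (W : Submodule K M) (ε : ι → ℤ) : Prop where
  eq_one_or : ∀ i, P.root i ∈ W → ε i = 1 ∨ ε i = -1
  neg : ∀ i j, P.root i ∈ W → P.root j = -P.root i → ε j = ε i
  add : ∀ i j k, P.root i ∈ W → P.root j ∈ W → P.root k = P.root i + P.root j →
    ε k = ε i * ε j

open Classical in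
/-- The Cayley transform of a sign function along the root `a`. -/
noncomputable def cayleyTransform (a : ι) (ε : ι → ℤ) (i : ι) : ℤ :=
  if P.root i + P.root a ∈ Set.range P.root then -ε i else ε i

namespace IsSignCharacterOn

variable {P} [Finite ι] [P.IsCrystallographic] [P.IsReduced]
  {W : Submodule K M} {ε : ι → ℤ} {a : ι}

omit [CharZero K] [Finite ι] [P.IsCrystallographic] [P.IsReduced] in
lemma apply_sub (hε : P.IsSignCharacterOn W ε) (ha : P.root a ∈ W) (hεa : ε a = -1) {i j : ι}
    (hi : P.root i ∈ W) (hj : P.root j = P.root i - P.root a) : ε j = -ε i := by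
  have := hε.add j a i (hj ▸ W.sub_mem hi ha) ha (by rw [hj]; abel)
  rw [hεa] at this
  omega

omit [P.IsReduced] in
lemma apply_reflectionPerm_of_pos (hε : P.IsSignCharacterOn W ε) (ha : P.root a ∈ W)
    (hεa : ε a = -1) {i : ι} (hi : P.root i ∈ W)
    (hc : P.pairingIn ℤ i a = 1 ∨ P.pairingIn ℤ i a = 3) :
    ε (P.reflectionPerm a i) = -ε i := by
  have hr := P.root_reflectionPerm_eq_sub a i
  rcases hc with hc | hc
  · exact hε.apply_sub ha hεa hi (by rw [hr, hc, one_smul])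
  · obtain ⟨j, hj⟩ := P.root_sub_root_mem_of_pairingIn_pos (i := i) (j := a) (by omega)
      (by rintro rfl; simp at hc)
    have hjW : P.root j ∈ W := hj ▸ W.sub_mem hi ha
    have hja := P.pairingIn_eq_of_root_eq_sub hj a
    rw [pairingIn_same, hc] at hja
    have hr' := P.root_reflectionPerm_eq_sub a j
    rw [hja, hj] at hr'
    have hkW : P.root (P.reflectionPerm a j) ∈ W := by
      rw [hr']; exact W.sub_mem (W.sub_mem hi ha) (W.smul_of_tower_mem _ ha)
    rw [hε.apply_sub ha hεa hkW (j := P.reflectionPerm a i)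
        (by rw [hr, hr', hc]; module),
      hε.apply_sub ha hεa hjW (j := P.reflectionPerm a j) (by rw [hr', hj]; module),
      hε.apply_sub ha hεa hi hj]
    ring

omit [CharZero K] [Finite ι] [P.IsReduced] in
lemma root_reflectionPerm_mem (ha : P.root a ∈ W) {i : ι} (hi : P.root i ∈ W) :
    P.root (P.reflectionPerm a i) ∈ W := by
  rw [root_reflectionPerm_eq_sub]
  exact W.sub_mem hi (W.smul_of_tower_mem _ ha)

lemma pairingIn_cases (i a : ι) : P.pairingIn ℤ i a = 0 ∨ P.pairingIn ℤ i a = 1 ∨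
    P.pairingIn ℤ i a = 2 ∨ P.pairingIn ℤ i a = 3 ∨ P.pairingIn ℤ i a = -1 ∨
    P.pairingIn ℤ i a = -2 ∨ P.pairingIn ℤ i a = -3 := by
  have := P.pairingIn_pairingIn_mem_set_of_isCrystal_of_isRed i a
  simp only [Set.mem_insert_iff, Prod.mk.injEq, Set.mem_singleton_iff] at this
  omega

lemma apply_reflectionPerm_of_odd (hε : P.IsSignCharacterOn W ε) (ha : P.root a ∈ W)
    (hεa : ε a = -1) {i : ι} (hi : P.root i ∈ W) (hc : Odd (P.pairingIn ℤ i a)) :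
    ε (P.reflectionPerm a i) = -ε i := by
  have hc' : ¬ Even (P.pairingIn ℤ i a) := by simpa using hc
  have h1 := P.pairingIn_reflectionPerm_left a i
  rcases pairingIn_cases (P := P) i a with h | h | h | h | h | h | h
  · simp [h] at hc
  · exact hε.apply_reflectionPerm_of_pos ha hεa hi (.inl h)
  · exact absurd (h ▸ by decide) hc'
  · exact hε.apply_reflectionPerm_of_pos ha hεa hi (.inr h)
  · have := hε.apply_reflectionPerm_of_pos ha hεa (root_reflectionPerm_mem ha hi)
      (.inl (by rw [h1, h, neg_neg]))
    rw [reflectionPerm_self] at this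
    rw [this, neg_neg]
  · exact absurd (h ▸ by decide) hc'
  · have := hε.apply_reflectionPerm_of_pos ha hεa (root_reflectionPerm_mem ha hi)
      (.inr (by rw [h1, h, neg_neg]))
    rw [reflectionPerm_self] at this
    rw [this, neg_neg]

omit [Finite ι] [P.IsReduced] in
lemma mem_inf_ker_iff {i : ι} : P.root i ∈ W ⊓ LinearMap.ker (P.coroot' a) ↔
    P.root i ∈ W ∧ P.pairingIn ℤ i a = 0 := by
  rw [Submodule.mem_inf, LinearMap.mem_ker, pairingIn_eq_iff_coroot', Int.cast_zero]

protected lemma cayleyTransform (hε : P.IsSignCharacterOn W ε) :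
    P.IsSignCharacterOn (W ⊓ LinearMap.ker (P.coroot' a)) (P.cayleyTransform a ε) where
  eq_one_or i hi := by
    have := hε.eq_one_or i (mem_inf_ker_iff.1 hi).1
    rw [RootPairing.cayleyTransform]
    split_ifs <;> omega
  neg i j hi hij := by
    obtain ⟨hiW, hi0⟩ := mem_inf_ker_iff.1 hi
    have h1 := P.root_add_mem_of_neg_of_orthogonal hij hi0
    have h2 := P.root_add_mem_of_neg_of_orthogonal (i := j) (j := i) (a := a) (by rw [hij, neg_neg])
      (by rw [P.pairingIn_eq_of_root_eq_neg hij, hi0, neg_zero])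
    simp only [RootPairing.cayleyTransform, hε.neg i j hiW hij]
    split_ifs <;> first | rfl | tauto
  add i j k hi hj hk := by
    obtain ⟨hiW, hi0⟩ := mem_inf_ker_iff.1 hi
    obtain ⟨hjW, hj0⟩ := mem_inf_ker_iff.1 hj
    have h := P.root_add_mem_iff_of_orthogonal hi0 hj0 hk
    simp only [RootPairing.cayleyTransform, hε.add i j k hiW hjW hk]
    split_ifs <;> first | tauto | ring

open Classical in
lemma sum_eq_cayleyTransform [Fintype ι] (hε : P.IsSignCharacterOn W ε) (ha : P.root a ∈ W)
    (hεa : ε a = -1) :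
    ∑ i with P.root i ∈ W, ε i =
      -2 + ∑ i with P.root i ∈ W ⊓ LinearMap.ker (P.coroot' a), P.cayleyTransform a ε i := by
  have hodd : ∑ i with P.root i ∈ W ∧ Odd (P.pairingIn ℤ i a), ε i = 0 := by
    refine Finset.sum_involution (fun i _ ↦ P.reflectionPerm a i) ?_ ?_ ?_ ?_
    · intro i hi
      obtain ⟨hi, hc⟩ := by simpa using hi
      rw [hε.apply_reflectionPerm_of_odd ha hεa hi (by simpa using hc)]; ring
    · intro i hi _ h
      obtain ⟨-, hc⟩ := by simpa using hi
      have := P.pairingIn_reflectionPerm_left a i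
      rw [h] at this
      rw [show P.pairingIn ℤ i a = 0 by omega] at hc
      simp at hc
    · intro i hi
      obtain ⟨hi, hc⟩ := by simpa using hi
      simp only [Finset.mem_filter, Finset.mem_univ, true_and, P.pairingIn_reflectionPerm_left]
      exact ⟨root_reflectionPerm_mem ha hi, by simpa using hc⟩
    · intro i _
      simp
  have htwo : ∑ i with P.root i ∈ W ∧ P.pairingIn ℤ i a = 2, ε i = -1 -
      ∑ i with P.root i ∈ W ∧ P.pairingIn ℤ i a = 0 ∧
        P.root i + P.root a ∈ Set.range P.root, ε i := by
    have hmem : a ∈ Finset.univ.filter (fun i ↦ P.root i ∈ W ∧ P.pairingIn ℤ i a = 2) := by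
      simp [ha]
    rw [← Finset.add_sum_erase _ _ hmem, hεa, sub_eq_add_neg, ← Finset.sum_neg_distrib]
    congr 1
    have key : ∀ i ∈ (Finset.univ.filter
        (fun i ↦ P.root i ∈ W ∧ P.pairingIn ℤ i a = 2)).erase a,
        ∃ j, P.root j = P.root i - P.root a := by
      intro i hi
      simp only [Finset.mem_erase, Finset.mem_filter, Finset.mem_univ, true_and] at hi
      exact P.root_sub_root_mem_of_pairingIn_pos (by omega) hi.1
    choose! s hs using key
    refine Finset.sum_bij (fun i _ ↦ s i) ?_ ?_ ?_ ?_
    · intro i hi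
      have hsi := hs i hi
      simp only [Finset.mem_erase, Finset.mem_filter, Finset.mem_univ, true_and] at hi ⊢
      refine ⟨hsi ▸ W.sub_mem hi.2.1 ha, ?_, ⟨i, by rw [hsi]; abel⟩⟩
      rw [P.pairingIn_eq_of_root_eq_sub hsi, hi.2.2, pairingIn_same]; rfl
    · intro i hi j hj hij
      apply P.root.injective
      have := hs i hi
      rw [hij, hs j hj] at this
      exact (sub_left_inj.1 this).symm
    · intro j hj
      simp only [Finset.mem_filter, Finset.mem_univ, true_and] at hj
      obtain ⟨hjW, hj0, i, hi⟩ := hj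
      have him : i ∈ (Finset.univ.filter
          (fun i ↦ P.root i ∈ W ∧ P.pairingIn ℤ i a = 2)).erase a := by
        simp only [Finset.mem_erase, Finset.mem_filter, Finset.mem_univ, true_and]
        refine ⟨?_, hi ▸ W.add_mem hjW ha, ?_⟩
        · rintro rfl
          exact P.ne_zero j (by simpa using hi)
        · rw [P.pairingIn_eq_of_root_eq_add hi, hj0, pairingIn_same]; rfl
      exact ⟨i, him, P.root.injective (by rw [hs i him, hi]; abel)⟩
    · intro i hi
      have hsi := hs i hi
      simp only [Finset.mem_erase, Finset.mem_filter, Finset.mem_univ, true_and] at hi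
      rw [hε.apply_sub ha hεa hi.2.1 hsi, neg_neg]
  have hnegtwo : ∑ i with P.root i ∈ W ∧ P.pairingIn ℤ i a = -2, ε i =
      ∑ i with P.root i ∈ W ∧ P.pairingIn ℤ i a = 2, ε i := by
    refine Finset.sum_bij (fun i _ ↦ P.reflectionPerm i i) ?_ ?_ ?_ ?_
    · intro i hi
      simpa [P.pairingIn_eq_of_root_eq_neg (i := i) (j := P.reflectionPerm i i) (by simp),
        neg_eq_iff_eq_neg] using hi
    · intro i hi j hj hij
      apply P.root.injective
      have := congrArg P.root hij
      simpa using this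
    · intro i hi
      refine ⟨P.reflectionPerm i i, ?_, ?_⟩
      · simpa [P.pairingIn_eq_of_root_eq_neg (i := i) (j := P.reflectionPerm i i) (by simp),
          neg_eq_iff_eq_neg] using hi
      · apply P.root.injective
        have hneg (j : ι) : P.root (P.reflectionPerm j j) = -P.root j := by simp
        rw [hneg, hneg, neg_neg]
    · intro i hi
      simp only [Finset.mem_filter, Finset.mem_univ, true_and] at hi
      exact (hε.neg i _ hi.1 (by simp)).symm
  have hsplit : ∑ i with P.root i ∈ W, ε i =
      ∑ i with P.root i ∈ W ∧ P.pairingIn ℤ i a = 0, ε i +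
      ∑ i with P.root i ∈ W ∧ Odd (P.pairingIn ℤ i a), ε i +
      ∑ i with P.root i ∈ W ∧ P.pairingIn ℤ i a = 2, ε i +
      ∑ i with P.root i ∈ W ∧ P.pairingIn ℤ i a = -2, ε i := by
    simp only [Finset.sum_filter, ← Finset.sum_add_distrib]
    refine Finset.sum_congr rfl fun i _ ↦ ?_
    by_cases hi : P.root i ∈ W
    · rcases pairingIn_cases (P := P) i a with h | h | h | h | h | h | h <;>
        simp [h, hi, show Odd (3 : ℤ) by decide, show ¬ Odd (2 : ℤ) by decide]
    · simp [hi]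
  have hcayley : ∑ i with P.root i ∈ W ⊓ LinearMap.ker (P.coroot' a), P.cayleyTransform a ε i =
      ∑ i with P.root i ∈ W ∧ P.pairingIn ℤ i a = 0, ε i -
      2 * ∑ i with P.root i ∈ W ∧ P.pairingIn ℤ i a = 0 ∧
        P.root i + P.root a ∈ Set.range P.root, ε i := by
    simp only [Finset.sum_filter, mem_inf_ker_iff, RootPairing.cayleyTransform, Finset.mul_sum,
      ← Finset.sum_sub_distrib]
    refine Finset.sum_congr rfl fun i _ ↦ ?_
    by_cases h1 : P.root i ∈ W ∧ P.pairingIn ℤ i a = 0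
    · by_cases h2 : P.root i + P.root a ∈ Set.range P.root
      · rw [if_pos h1, if_pos h2, if_pos h1, if_pos ⟨h1.1, h1.2, h2⟩]; ring
      · rw [if_pos h1, if_neg h2, if_pos h1, if_neg (by tauto)]; ring
    · rw [if_neg h1, if_neg h1, if_neg (by tauto)]; ring
  rw [hsplit, hcayley, hodd, hnegtwo, htwo]
  ring

open Classical in
/-- The signed count of the roots in a subspace `W` is bounded below by `-2 dim W`. -/
theorem neg_two_mul_finrank_le_sum [Fintype ι] [FiniteDimensional K M]
    (hε : P.IsSignCharacterOn W ε) :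
    -2 * (Module.finrank K W : ℤ) ≤ ∑ i with P.root i ∈ W, ε i := by
  induction hn : Module.finrank K W using Nat.strong_induction_on generalizing W ε with
  | _ n ih =>
    by_cases h : ∃ a, P.root a ∈ W ∧ ε a = -1
    · obtain ⟨a, ha, hεa⟩ := h
      have hlt : W ⊓ LinearMap.ker (P.coroot' a) < W := by
        refine lt_of_le_of_ne inf_le_left fun h ↦ ?_
        have := h ▸ ha
        simp at this
      have hrank := Submodule.finrank_lt_finrank_of_lt hlt
      have := ih _ (hn ▸ hrank) (hε.cayleyTransform (a := a)) rfl
      rw [hε.sum_eq_cayleyTransform ha hεa]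
      omega
    · push Not at h
      have : 0 ≤ ∑ i with P.root i ∈ W, ε i := by
        refine Finset.sum_nonneg fun i hi ↦ ?_
        simp only [Finset.mem_filter, Finset.mem_univ, true_and] at hi
        have := hε.eq_one_or i hi
        have := h i hi
        omega
      omega

end IsSignCharacterOn

end RootPairing
namespace LinearMap

open Module

lemma trace_eq_of_involutive {K V : Type*} [Field K] [CharZero K] [AddCommGroup V] [Module K V]
    [FiniteDimensional K V] (f : V →ₗ[K] V) (hf : ∀ x, f (f x) = x) :
    trace K V f = 2 * (finrank K (eqLocus f id) : K) - finrank K V := by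
  have hp : IsProj (eqLocus f id) ((2⁻¹ : K) • (id + f)) := by
    refine ⟨fun x ↦ ?_, fun x hx ↦ ?_⟩
    · simp [mem_eqLocus, hf, add_comm]
    · rw [mem_eqLocus, id_apply] at hx
      simp only [smul_apply, add_apply, id_apply, hx]
      module
  have := hp.trace
  rw [map_smul, map_add, trace_id, smul_eq_mul] at this
  linear_combination 2 * this

open DirectSum in
/-- The trace of an endomorphism permuting the summands of a direct sum decomposition is the
sum of the traces on the summands it preserves. -/
lemma trace_eq_sum_trace_restrict_of_mapsTo {ι R M : Type*} [CommRing R] [AddCommGroup M]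
    [Module R M] [Fintype ι] [DecidableEq ι] {N : ι → Submodule R M} [∀ i, Module.Finite R (N i)]
    [∀ i, Module.Free R (N i)] (h : IsInternal N) (σ : ι → ι) {f : M →ₗ[R] M}
    (hf : ∀ i, Set.MapsTo f (N i) (N (σ i))) :
    trace R M f = ∑ i, if hi : σ i = i then
      trace R (N i) (f.restrict fun _ hx ↦ (congrArg N hi).le (hf i hx)) else 0 := by
  let b : (i : ι) → Basis _ R (N i) := fun i ↦ Module.Free.chooseBasis R (N i)
  rw [trace_eq_matrix_trace R (h.collectedBasis b), Matrix.trace, Fintype.sum_sigma]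
  refine Finset.sum_congr rfl fun i _ ↦ ?_
  simp only [Matrix.diag_apply, toMatrix_apply, IsInternal.collectedBasis_coe]
  split_ifs with hi
  · rw [trace_eq_matrix_trace R (b i), Matrix.trace]
    refine Finset.sum_congr rfl fun a _ ↦ ?_
    have hfi : Set.MapsTo f (N i) (N i) := fun _ hx ↦ (congrArg N hi).le (hf i hx)
    rw [h.collectedBasis_repr_of_mem b (hfi (b i a).2), Matrix.diag_apply, toMatrix_apply]
    rfl
  · exact Finset.sum_eq_zero fun a _ ↦ h.collectedBasis_repr_of_mem_ne b hi (hf i (b i a).2)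

end LinearMap

namespace LieAlgebra.IsKilling

open LieModule Module

variable {K L : Type*} [Field K] [CharZero K] [LieRing L] [LieAlgebra K L]
  [IsKilling K L] [FiniteDimensional K L]
  {H : LieSubalgebra K L} [H.IsCartanSubalgebra] [IsTriangularizable K H L]

lemma mem_rootSpace_iff {χ : H → K} {x : L} :
    x ∈ rootSpace H χ ↔ ∀ h : H, ⁅(h : L), x⁆ = χ h • x :=
  ⟨fun hx h ↦ lie_eq_smul_of_mem_rootSpace hx h,
    fun hx ↦ weightSpace_le_genWeightSpace L χ ((mem_weightSpace χ x).2 hx)⟩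

lemma exists_smul_eq_of_mem_rootSpace {α : Weight K H L} (hα : α.IsNonZero) {x y : L}
    (hx : x ∈ rootSpace H α) (hx0 : x ≠ 0) (hy : y ∈ rootSpace H α) : ∃ c : K, c • x = y := by
  obtain ⟨c, hc⟩ := (finrank_eq_one_iff_of_nonzero' (⟨x, hx⟩ : rootSpace H α)
    (by simpa [LieSubmodule.mk_eq_zero] using hx0)).1 (finrank_rootSpace_eq_one α hα) ⟨y, hy⟩
  exact ⟨c, by simpa using congrArg Subtype.val hc⟩

lemma lie_ne_zero_of_mem_rootSpace {α β : Weight K H L} (hα : α.IsNonZero) (hβ : β.IsNonZero)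
    (hαβ : rootSpace H (α + β) ≠ ⊥) {x y : L} (hx : x ∈ rootSpace H α) (hx0 : x ≠ 0)
    (hy : y ∈ rootSpace H β) (hy0 : y ≠ 0) : ⁅x, y⁆ ≠ 0 := by
  obtain ⟨h, e, f, isSl2, he, hf⟩ := exists_isSl2Triple_of_weight_isNonZero hα
  obtain rfl := isSl2.h_eq_coroot hα he hf
  obtain ⟨v, hv, hv0⟩ := (chainTop α β).exists_ne_zero
  have prim : isSl2.HasPrimitiveVectorWith v (chainLength α β : K) :=
    have := lie_mem_genWeightSpace_of_mem_genWeightSpace he hv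
    ⟨hv0, (chainLength_smul _ _ hv).symm, by rwa [genWeightSpace_add_chainTop _ _ hα] at this⟩
  have hle := chainTopCoeff_le_chainLength α β
  have hpos : 1 ≤ chainTopCoeff α β := by
    have := ((rootSpace_zsmul_add_ne_bot_iff α β hα 1).1 (by rwa [one_smul])).1
    omega
  obtain ⟨p, hp⟩ := Nat.exists_eq_add_of_le' hpos
  have hu : (toEnd K L L f ^ (p + 1)) v ∈ rootSpace H β := by
    have := toEnd_pow_apply_mem hf hv (p + 1)
    rwa [coe_chainTop, hp, smul_neg, ← Nat.cast_smul_eq_nsmul ℤ, neg_add_cancel_left] at this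
  have heu := prim.lie_e_pow_succ_toEnd_f p
  have hne : ⁅e, (toEnd K L L f ^ (p + 1)) v⁆ ≠ 0 := by
    rw [heu]
    refine smul_ne_zero (mul_ne_zero (by norm_cast) ?_)
      (prim.pow_toEnd_f_ne_zero_of_eq_nat rfl (by omega))
    rw [sub_ne_zero]
    norm_cast
    omega
  intro hxy
  obtain ⟨c, hc⟩ := exists_smul_eq_of_mem_rootSpace hα hx hx0 he
  obtain ⟨d, hd⟩ := exists_smul_eq_of_mem_rootSpace hβ hy hy0 hu
  apply hne
  rw [← hc, ← hd, lie_smul, smul_lie, hxy, smul_zero, smul_zero]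

section involution

variable (τ : L ≃ₗ⁅K⁆ L) (hH : ∀ x ∈ H, τ x ∈ H)

/-- The restriction to a Cartan subalgebra of an automorphism preserving it. -/
def cartanRestrict : H →ₗ[K] H where
  toFun y := ⟨τ y, hH y y.2⟩
  map_add' x y := Subtype.ext <| by simp
  map_smul' c x := Subtype.ext <| by simp

omit [CharZero K] [IsKilling K L] [FiniteDimensional K L] [H.IsCartanSubalgebra]
  [IsTriangularizable K H L] in
@[simp] lemma coe_cartanRestrict (y : H) : (cartanRestrict τ hH y : L) = τ y := rfl

open Classical in
/-- The eigenvalue with which an involution acts on the root space of a fixed root. -/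
noncomputable def rootSign (α : Weight K H L) : ℤ :=
  if ∃ x ∈ rootSpace H α, x ≠ 0 ∧ τ x = x then 1 else -1

omit [CharZero K] [IsKilling K L] [IsTriangularizable K H L] [FiniteDimensional K L] in
lemma rootSign_eq_one_or [IsNoetherian K L] (α : Weight K H L) :
    rootSign τ α = 1 ∨ rootSign τ α = -1 := by
  rw [rootSign]
  split_ifs <;> simp

variable {τ} (hinv : ∀ x, τ (τ x) = x)
include hinv

omit [CharZero K] [IsKilling K L] [FiniteDimensional K L] [H.IsCartanSubalgebra]
  [IsTriangularizable K H L] in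
lemma cartanRestrict_cartanRestrict (y : H) :
    cartanRestrict τ hH (cartanRestrict τ hH y) = y :=
  Subtype.ext (hinv y)

lemma map_mem_rootSpace {χ : H → K} {x : L} (hx : x ∈ rootSpace H χ) :
    τ x ∈ rootSpace H (χ ∘ cartanRestrict τ hH) := by
  rw [mem_rootSpace_iff] at hx ⊢
  intro h
  have := congrArg τ (hx (cartanRestrict τ hH h))
  rw [LieEquiv.map_lie, coe_cartanRestrict, hinv] at this
  rw [this]
  simp

/-- The action on weights of an involution preserving the Cartan subalgebra. -/
def weightTwist (α : Weight K H L) : Weight K H L where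
  toFun := α ∘ cartanRestrict τ hH
  genWeightSpace_ne_bot' := by
    obtain ⟨x, hx, hx0⟩ := α.exists_ne_zero
    refine fun h ↦ hx0 ?_
    have := map_mem_rootSpace hH hinv hx
    rwa [rootSpace, h, LieSubmodule.mem_bot, EmbeddingLike.map_eq_zero_iff] at this

variable {α β γ : Weight K H L}

lemma weightTwist_eq_self_iff : weightTwist hH hinv α = α ↔ ∀ y, α y = α (cartanRestrict τ hH y) :=
  ⟨fun h y ↦ congrFun (congrArg DFunLike.coe h.symm) y, fun h ↦ Weight.ext fun y ↦ (h y).symm⟩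

variable (hα : α.IsNonZero) (hατ : ∀ y, α y = α (cartanRestrict τ hH y))
include hα hατ

omit hα in
lemma map_mem_rootSpace_of_fixed {x : L} (hx : x ∈ rootSpace H α) : τ x ∈ rootSpace H α := by
  have := map_mem_rootSpace hH hinv hx
  rwa [← show (α : H → K) = α ∘ cartanRestrict τ hH from funext hατ] at this

lemma apply_eq_rootSign_smul {x : L} (hx : x ∈ rootSpace H α) : τ x = rootSign τ α • x := by
  rcases eq_or_ne x 0 with rfl | hx0
  · simp
  obtain ⟨c, hc⟩ := exists_smul_eq_of_mem_rootSpace hα hx hx0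
    (map_mem_rootSpace_of_fixed hH hinv hατ hx)
  have hcc : c * c = 1 := by
    have := hinv x
    rw [← hc, map_smul, ← hc, smul_smul] at this
    exact smul_left_injective K hx0 (this.trans (one_smul K x).symm)
  rcases mul_self_eq_one_iff.1 hcc with rfl | rfl
  · rw [rootSign, if_pos ⟨x, hx, hx0, by rw [← hc, one_smul]⟩, ← hc, one_smul, one_smul]
  · rw [rootSign, if_neg, ← hc, neg_smul, neg_smul, one_smul, one_smul]
    rintro ⟨y, hy, hy0, hτy⟩
    obtain ⟨d, rfl⟩ := exists_smul_eq_of_mem_rootSpace hα hx hx0 hy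
    rw [map_smul, ← hc, smul_comm, neg_smul, one_smul] at hτy
    have h2 : (2 : K) • d • x = 0 := by
      rw [two_smul]
      nth_rewrite 1 [← hτy]
      exact neg_add_cancel _
    exact hy0 ((smul_eq_zero_iff_right two_ne_zero).1 h2)

lemma rootSign_eq_of_apply_eq {x : L} (hx : x ∈ rootSpace H α) (hx0 : x ≠ 0) {n : ℤ}
    (h : τ x = n • x) : rootSign τ α = n := by
  rw [apply_eq_rootSign_smul hH hinv hα hατ hx, ← sub_eq_zero, ← sub_smul,
    ← Int.cast_smul_eq_zsmul K, smul_eq_zero_iff_left hx0] at h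
  norm_cast at h
  omega

lemma rootSign_add (hβ : β.IsNonZero) (hβτ : ∀ y, β y = β (cartanRestrict τ hH y))
    (hγ : γ.IsNonZero) (hγτ : ∀ y, γ y = γ (cartanRestrict τ hH y))
    (h : (γ : H → K) = α + β) : rootSign τ γ = rootSign τ α * rootSign τ β := by
  obtain ⟨x, hx, hx0⟩ := α.exists_ne_zero
  obtain ⟨y, hy, hy0⟩ := β.exists_ne_zero
  refine rootSign_eq_of_apply_eq hH hinv hγ hγτ (x := ⁅x, y⁆) ?_
    (lie_ne_zero_of_mem_rootSpace hα hβ (h ▸ γ.genWeightSpace_ne_bot) hx hx0 hy hy0) ?_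
  · exact h ▸ lie_mem_genWeightSpace_of_mem_genWeightSpace hx hy
  · rw [LieEquiv.map_lie, apply_eq_rootSign_smul hH hinv hα hατ hx,
      apply_eq_rootSign_smul hH hinv hβ hβτ hy, smul_lie, lie_smul, smul_smul]

lemma rootSign_neg : rootSign τ (-α) = rootSign τ α := by
  obtain ⟨h, e, f, isSl2, he, hf⟩ := exists_isSl2Triple_of_weight_isNonZero hα
  obtain rfl := isSl2.h_eq_coroot hα he hf
  have hneg : ∀ y, (-α) y = (-α) (cartanRestrict τ hH y) := fun y ↦ by simp [← hατ y]
  have key := congrArg τ isSl2.lie_e_f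
  rw [LieEquiv.map_lie, apply_eq_rootSign_smul hH hinv hα hατ he,
    apply_eq_rootSign_smul hH hinv hα.neg hneg (by simpa using hf), smul_lie, lie_smul,
    smul_smul, isSl2.lie_e_f] at key
  have h2 := congrArg α (Subtype.ext key : (rootSign τ α * rootSign τ (-α)) • coroot α =
    cartanRestrict τ hH (coroot α))
  rw [← hατ, ← Int.cast_smul_eq_zsmul K, ← Weight.toLinear_apply, map_smul,
    Weight.toLinear_apply, root_apply_coroot hα, smul_eq_mul] at h2
  have h1 : rootSign τ α * rootSign τ (-α) = 1 := by
    have : ((rootSign τ α * rootSign τ (-α) : ℤ) : K) = 1 := by linear_combination h2 / 2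
    exact_mod_cast this
  rcases rootSign_eq_one_or τ α with h | h <;> rw [h] at h1 ⊢ <;> omega

lemma map_coroot : τ (coroot α) = coroot α := by
  obtain ⟨h, e, f, isSl2, he, hf⟩ := exists_isSl2Triple_of_weight_isNonZero hα
  obtain rfl := isSl2.h_eq_coroot hα he hf
  have hneg : ∀ y, (-α) y = (-α) (cartanRestrict τ hH y) := fun y ↦ by simp [← hατ y]
  rw [← isSl2.lie_e_f, LieEquiv.map_lie, apply_eq_rootSign_smul hH hinv hα hατ he,
    apply_eq_rootSign_smul hH hinv hα.neg hneg (by simpa using hf), smul_lie, lie_smul,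
    rootSign_neg hH hinv hα hατ, smul_smul]
  rcases rootSign_eq_one_or τ α with h | h <;> simp [h]

end involution

section count

omit [CharZero K] [IsKilling K L] in
lemma isInternal_rootSpace [DecidableEq (Weight K H L)] :
    DirectSum.IsInternal fun α : Weight K H L ↦ (rootSpace H α).toSubmodule := by
  refine DirectSum.isInternal_submodule_of_iSupIndep_of_iSup_eq_top ?_ ?_
  · exact LieSubmodule.iSupIndep_toSubmodule.2 (iSupIndep_genWeightSpace' K H L)
  · rw [← LieSubmodule.iSup_toSubmodule, iSup_genWeightSpace_eq_top',
      LieSubmodule.top_toSubmodule]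

omit [CharZero K] [IsKilling K L] [IsTriangularizable K H L] in
lemma finrank_rootSpace_zero : finrank K (rootSpace H (0 : H → K)) = finrank K H := by
  rw [rootSpace_zero_eq]
  rfl

open Classical in
lemma finrank_eq_finrank_add_card [Nontrivial L] :
    finrank K L = finrank K H + Nat.card {α : Weight K H L // α.IsNonZero} := by
  have := (LinearEquiv.ofBijective (DirectSum.coeLinearMap fun α : Weight K H L ↦
    (rootSpace H α).toSubmodule) isInternal_rootSpace).finrank_eq
  rw [finrank_directSum, ← Finset.add_sum_erase _ _ (Finset.mem_univ 0)] at this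
  rw [← this]
  congr 1
  · exact finrank_rootSpace_zero
  · rw [Finset.sum_eq_card_nsmul (b := 1), smul_eq_mul, mul_one, Nat.card_eq_fintype_card,
      Fintype.card_subtype]
    · congr 1
      ext α
      simp [Weight.IsNonZero, Weight.isZero_iff_eq_zero]
    · intro α hα
      refine finrank_rootSpace_eq_one α ?_
      simpa [Weight.IsNonZero, Weight.isZero_iff_eq_zero] using hα

variable {τ : L ≃ₗ⁅K⁆ L} (hH : ∀ x ∈ H, τ x ∈ H) (hinv : ∀ x, τ (τ x) = x)
include hinv

open Classical in
lemma trace_eq_trace_cartanRestrict_add_sum [Nontrivial L] :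
    LinearMap.trace K L (τ : L →ₗ[K] L) = LinearMap.trace K H (cartanRestrict τ hH) +
      ∑ α : Weight K H L with α.IsNonZero ∧ ∀ y, α y = α (cartanRestrict τ hH y),
        (rootSign τ α : K) := by
  rw [LinearMap.trace_eq_sum_trace_restrict_of_mapsTo isInternal_rootSpace (weightTwist hH hinv)
    (f := (τ : L →ₗ[K] L)) fun α x hx ↦ map_mem_rootSpace hH hinv hx,
    ← Finset.add_sum_erase _ _ (Finset.mem_univ 0)]
  congr 1
  · have h0 : weightTwist hH hinv (0 : Weight K H L) = 0 := by
      rw [weightTwist_eq_self_iff]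
      simp
    rw [dif_pos h0]
    have key : ∀ (p q : Submodule K L) (hp : ∀ x ∈ p, τ x ∈ p) (hq : ∀ x ∈ q, τ x ∈ q), p = q →
        LinearMap.trace K p ((τ : L →ₗ[K] L).restrict hp) =
          LinearMap.trace K q ((τ : L →ₗ[K] L).restrict hq) := by
      rintro p _ _ _ rfl
      rfl
    refine key _ H.toSubmodule _ hH ?_
    rw [FunLike.coe_zero, rootSpace_zero_eq]
    rfl
  · have : Finset.univ.filter (fun α : Weight K H L ↦
        α.IsNonZero ∧ ∀ y, α y = α (cartanRestrict τ hH y)) =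
        (Finset.univ.erase 0).filter fun α ↦ weightTwist hH hinv α = α := by
      ext α
      simp [Weight.IsNonZero, Weight.isZero_iff_eq_zero, weightTwist_eq_self_iff]
    rw [this, Finset.sum_filter]
    refine Finset.sum_congr rfl fun α hα ↦ ?_
    split_ifs with hατ
    · have hα' : α.IsNonZero := by simpa [Weight.IsNonZero, Weight.isZero_iff_eq_zero] using hα
      rw [weightTwist_eq_self_iff] at hατ
      have : ∀ h, (τ : L →ₗ[K] L).restrict (p := (rootSpace H α).toSubmodule) h =
          (rootSign τ α : K) • LinearMap.id := by
        intro h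
        ext x
        simpa [Int.cast_smul_eq_zsmul] using apply_eq_rootSign_smul hH hinv hα' hατ x.2
      rw [this, map_smul, LinearMap.trace_id]
      have := finrank_rootSpace_eq_one α hα'
      rw [show finrank K (rootSpace H α).toSubmodule = 1 from this]
      simp
    · rfl

open Classical in
lemma sum_rootSign_eq (hsplit : 2 * finrank K (LinearMap.eqLocus (τ : L →ₗ[K] L) LinearMap.id) =
      Nat.card {α : Weight K H L // α.IsNonZero}) :
    ∑ α : Weight K H L with α.IsNonZero ∧ ∀ y, α y = α (cartanRestrict τ hH y), rootSign τ α =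
      -2 * finrank K (LinearMap.eqLocus (cartanRestrict τ hH) LinearMap.id) := by
  cases subsingleton_or_nontrivial L with
  | inl _ =>
    have : IsEmpty (Weight K H L) :=
      ⟨fun α ↦ have ⟨x, _, hx⟩ := α.exists_ne_zero; hx (Subsingleton.elim _ _)⟩
    rw [finrank_zero_of_subsingleton]
    simp
  | inr _ =>
    have h1 := trace_eq_trace_cartanRestrict_add_sum hH hinv
    rw [LinearMap.trace_eq_of_involutive (τ : L →ₗ[K] L) hinv,
      LinearMap.trace_eq_of_involutive _ (cartanRestrict_cartanRestrict hH hinv),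
      finrank_eq_finrank_add_card (H := H), ← hsplit] at h1
    have : ((∑ α : Weight K H L with α.IsNonZero ∧ ∀ y, α y = α (cartanRestrict τ hH y),
        rootSign τ α : ℤ) : K) =
        ((-2 * finrank K (LinearMap.eqLocus (cartanRestrict τ hH) LinearMap.id) : ℤ) : K) := by
      push_cast at h1 ⊢
      linear_combination -h1
    exact_mod_cast this

end count

section fixedTorus

variable {τ : L ≃ₗ⁅K⁆ L} (hH : ∀ x ∈ H, τ x ∈ H) (hinv : ∀ x, τ (τ x) = x)

variable (τ) in
/-- The span of the roots fixed by an automorphism preserving the Cartan subalgebra. -/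
def fixedRootSpan : Submodule K (Dual K H) :=
  Submodule.span K {φ | ∃ α : Weight K H L, α.IsNonZero ∧
    (∀ y, α y = α (cartanRestrict τ hH y)) ∧ α.toLinear = φ}

omit [IsKilling K L] [IsTriangularizable K H L] in
lemma apply_cartanRestrict_of_mem_fixedRootSpan {φ : Dual K H} (hφ : φ ∈ fixedRootSpan τ hH)
    (y : H) : φ (cartanRestrict τ hH y) = φ y := by
  induction hφ using Submodule.span_induction with
  | mem φ h =>
    obtain ⟨α, -, hα, rfl⟩ := h
    exact (hα y).symm
  | zero => simp
  | add φ ψ _ _ h₁ h₂ => simp [h₁, h₂]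
  | smul c φ _ h => simp [h]

lemma root_mem_fixedRootSpan_iff (i : H.root) :
    (rootSystem H).root i ∈ fixedRootSpan τ hH ↔
      ∀ y, (i : Weight K H L) y = (i : Weight K H L) (cartanRestrict τ hH y) :=
  ⟨fun h y ↦ (apply_cartanRestrict_of_mem_fixedRootSpan hH h y).symm,
    fun h ↦ Submodule.subset_span ⟨i, H.isNonZero_coe_root i, h, rfl⟩⟩

include hinv

lemma isSignCharacterOn_rootSign :
    (rootSystem H).IsSignCharacterOn (fixedRootSpan τ hH) fun i ↦ rootSign τ (i : Weight K H L) := by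
  have hmem := root_mem_fixedRootSpan_iff (τ := τ) hH
  refine ⟨fun i _ ↦ by exact rootSign_eq_one_or τ i.1, fun i j hi hij ↦ ?_, fun i j k hi hj hk ↦ ?_⟩
  · have h : (j : Weight K H L) = -i := Weight.ext fun y ↦ LinearMap.congr_fun hij y
    exact (congrArg (rootSign τ) h).trans
      (rootSign_neg hH hinv (H.isNonZero_coe_root i) ((hmem i).1 hi))
  · have hk' : (rootSystem H).root k ∈ fixedRootSpan τ hH := hk ▸ add_mem hi hj
    exact rootSign_add hH hinv (H.isNonZero_coe_root i) ((hmem i).1 hi) (H.isNonZero_coe_root j)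
      ((hmem j).1 hj) (H.isNonZero_coe_root k) ((hmem k).1 hk')
      (funext fun y ↦ LinearMap.congr_fun hk y)

variable (hsplit : 2 * finrank K (LinearMap.eqLocus (τ : L →ₗ[K] L) LinearMap.id) =
  Nat.card {α : Weight K H L // α.IsNonZero})
include hsplit

open Classical in
lemma finrank_eqLocus_le_finrank_fixedRootSpan :
    finrank K (LinearMap.eqLocus (cartanRestrict τ hH) LinearMap.id) ≤
      finrank K (fixedRootSpan τ hH) := by
  have h1 := (isSignCharacterOn_rootSign hH hinv).neg_two_mul_finrank_le_sum
  have h2 := sum_rootSign_eq hH hinv hsplit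
  have h3 : ∑ i : H.root with (rootSystem H).root i ∈ fixedRootSpan τ hH,
      rootSign τ (i : Weight K H L) =
      ∑ α : Weight K H L with α.IsNonZero ∧ ∀ y, α y = α (cartanRestrict τ hH y),
        rootSign τ α := by
    refine Finset.sum_nbij (fun i ↦ (i : Weight K H L)) ?_ ?_ ?_ fun _ _ ↦ rfl
    · intro i hi
      simp only [Finset.mem_filter, Finset.mem_univ, true_and,
        root_mem_fixedRootSpan_iff] at hi ⊢
      exact ⟨H.isNonZero_coe_root i, hi⟩
    · exact Subtype.val_injective.injOn
    · intro α hα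
      rw [Finset.mem_coe, Finset.mem_filter] at hα
      refine ⟨⟨α, by simpa using hα.2.1⟩, ?_, rfl⟩
      rw [Finset.mem_coe, Finset.mem_filter]
      exact ⟨Finset.mem_univ _, (root_mem_fixedRootSpan_iff hH _).2 hα.2.2⟩
  rw [h3, h2] at h1
  omega

/-- The coroots of the roots fixed by a split involution span the fixed points of the Cartan
subalgebra. -/
lemma span_coroot_eq_eqLocus :
    Submodule.span K {x : H | ∃ α : Weight K H L, α.IsNonZero ∧
      (∀ y, α y = α (cartanRestrict τ hH y)) ∧ coroot α = x} =
      LinearMap.eqLocus (cartanRestrict τ hH) LinearMap.id := by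
  refine Submodule.eq_of_le_of_finrank_le (Submodule.span_le.2 ?_) ?_
  · rintro _ ⟨α, hα, hατ, rfl⟩
    exact Subtype.ext (map_coroot hH hinv hα hατ)
  refine (finrank_eqLocus_le_finrank_fixedRootSpan hH hinv hsplit).trans ?_
  rw [← LinearEquiv.finrank_map_eq (cartanEquivDual H)]
  refine Submodule.finrank_mono (Submodule.span_le.2 ?_)
  rintro _ ⟨α, hα, hατ, rfl⟩
  have hc := root_apply_cartanEquivDual_symm_ne_zero hα
  refine ⟨(2⁻¹ * α ((cartanEquivDual H).symm α) : K) • coroot α,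
    Submodule.smul_mem _ _ (Submodule.subset_span ⟨α, hα, hατ, rfl⟩), ?_⟩
  rw [coroot, ← Nat.cast_smul_eq_nsmul K, smul_smul, smul_smul,
    show (2⁻¹ * α ((cartanEquivDual H).symm α) * (2 : ℕ) *
      (α ((cartanEquivDual H).symm α))⁻¹ : K) = 1 by push_cast; field_simp, one_smul]
  simp

omit hsplit in
omit [CharZero K] [IsKilling K L] [FiniteDimensional K L] [H.IsCartanSubalgebra]
  [IsTriangularizable K H L] in
lemma traceForm_cartanRestrict (x y : H) :
    traceForm K H L (cartanRestrict τ hH x) y = traceForm K H L x (cartanRestrict τ hH y) := by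
  change killingForm K L (τ x) y = killingForm K L x (τ y)
  conv_lhs => rw [← hinv y]
  exact LieAlgebra.killingForm_of_equiv_apply τ (x : L) (τ y)

lemma eq_zero_of_forall_fixed_root_apply_eq_zero {x : H} (hx : cartanRestrict τ hH x = x)
    (h : ∀ α : Weight K H L, α.IsNonZero → (∀ y, α y = α (cartanRestrict τ hH y)) → α x = 0) :
    x = 0 := by
  have key : ∀ t ∈ LinearMap.eqLocus (cartanRestrict τ hH) LinearMap.id,
      traceForm K H L t x = 0 := by
    rw [← span_coroot_eq_eqLocus hH hinv hsplit]
    intro t ht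
    induction ht using Submodule.span_induction with
    | mem t ht =>
      obtain ⟨α, hα, hατ, rfl⟩ := ht
      rw [traceForm_coroot, h α hα hατ, smul_zero, smul_zero]
    | zero => simp
    | add s t _ _ h₁ h₂ => simp [h₁, h₂]
    | smul c t _ h => simp [h]
  refine (traceForm_cartan_nondegenerate K L H).2 x fun y ↦ ?_
  have h2 := key (y + cartanRestrict τ hH y)
    (by simp [LinearMap.mem_eqLocus, cartanRestrict_cartanRestrict hH hinv, add_comm])
  rw [map_add, LinearMap.add_apply, traceForm_cartanRestrict hH hinv, hx, ← two_mul] at h2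
  exact (mul_eq_zero_iff_left two_ne_zero).1 h2

end fixedTorus

section levi

variable {τ : L ≃ₗ⁅K⁆ L} (hH : ∀ x ∈ H, τ x ∈ H) (hinv : ∀ x, τ (τ x) = x)

lemma lie_eq_zero_of_mem_leviOfFixedRoots {z : H} (hz : cartanRestrict τ hH z = -z) {x : L}
    (hx : x ∈ leviOfFixedRoots H τ hH) : ⁅(z : L), x⁆ = 0 := by
  induction hx using LieSubalgebra.lieSpan_induction with
  | mem x h =>
    rcases h with h | h
    · exact congrArg Subtype.val (trivial_lie_zero H H z ⟨x, h⟩)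
    · obtain ⟨⟨α, hα, hατ⟩, hx⟩ := Set.mem_iUnion.1 h
      have h2 : α z = -α z := by
        have := hατ z
        rwa [show (⟨τ z, hH z z.2⟩ : H) = -z from hz, ← Weight.toLinear_apply, map_neg,
          Weight.toLinear_apply] at this
      rw [mem_rootSpace_iff.1 hx z, self_eq_neg.1 h2, zero_smul]
  | zero => simp
  | add x y _ _ h₁ h₂ => simp [h₁, h₂]
  | smul c x _ h => simp [h]
  | lie x y _ _ h₁ h₂ => rw [leibniz_lie, h₁, h₂, zero_lie, lie_zero, add_zero]

omit [CharZero K] [IsKilling K L] [FiniteDimensional K L] in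
lemma derivedOf_le (l : LieSubalgebra K L) : derivedOf l ≤ l :=
  LieSubalgebra.lieSpan_le.2 <| by
    rintro _ ⟨a, ha, b, hb, rfl⟩
    exact l.lie_mem ha hb

lemma killingForm_eq_zero_of_mem_derivedOf {z : H} (hz : cartanRestrict τ hH z = -z) {x : L}
    (hx : x ∈ derivedOf (leviOfFixedRoots H τ hH)) : killingForm K L z x = 0 := by
  have aux {a b : L} (ha : a ∈ leviOfFixedRoots H τ hH) : killingForm K L z ⁅a, b⁆ = 0 := by
    rw [← traceForm_apply_lie_apply, lie_eq_zero_of_mem_leviOfFixedRoots hH hz ha, map_zero,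
      LinearMap.zero_apply]
  induction hx using LieSubalgebra.lieSpan_induction with
  | mem x h =>
    obtain ⟨a, ha, b, -, rfl⟩ := h
    exact aux ha
  | zero => simp
  | add x y _ _ h₁ h₂ => simp [h₁, h₂]
  | smul c x _ h => simp [h]
  | lie x y hx _ _ _ => exact aux (derivedOf_le _ hx)

include hinv

lemma cartanRestrict_eq_self_of_mem_derivedOf {x : H}
    (hx : (x : L) ∈ derivedOf (leviOfFixedRoots H τ hH)) : cartanRestrict τ hH x = x := by
  rw [← sub_eq_zero]
  refine (traceForm_cartan_nondegenerate K L H).1 _ fun y ↦ ?_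
  have hz : cartanRestrict τ hH (cartanRestrict τ hH y - y) = -(cartanRestrict τ hH y - y) := by
    rw [map_sub, cartanRestrict_cartanRestrict hH hinv, neg_sub]
  have := killingForm_eq_zero_of_mem_derivedOf hH hz hx
  rw [traceForm_comm] at this
  rw [map_sub, LinearMap.sub_apply, traceForm_cartanRestrict hH hinv, ← map_sub]
  exact this

variable (hsplit : 2 * finrank K (LinearMap.eqLocus (τ : L →ₗ[K] L) LinearMap.id) =
  Nat.card {α : Weight K H L // α.IsNonZero})

omit hinv in
lemma coroot_mem_derivedOf {α : Weight K H L} (hα : α.IsNonZero)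
    (hατ : ∀ y, α y = α (cartanRestrict τ hH y)) :
    (coroot α : L) ∈ derivedOf (leviOfFixedRoots H τ hH) := by
  obtain ⟨h, e, f, isSl2, he, hf⟩ := exists_isSl2Triple_of_weight_isNonZero hα
  obtain rfl := isSl2.h_eq_coroot hα he hf
  have hneg : ∀ y, (-α) y = (-α) (cartanRestrict τ hH y) := fun y ↦ by simp [← hατ y]
  refine LieSubalgebra.subset_lieSpan ⟨e, ?_, f, ?_, isSl2.lie_e_f.symm⟩
  · exact LieSubalgebra.subset_lieSpan (Or.inr (Set.mem_iUnion.2 ⟨⟨α, hα, hατ⟩, he⟩))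
  · exact LieSubalgebra.subset_lieSpan
      (Or.inr (Set.mem_iUnion.2 ⟨⟨-α, hα.neg, hneg⟩, by simpa using hf⟩))

include hsplit in
lemma mem_derivedOf_iff {x : H} :
    (x : L) ∈ derivedOf (leviOfFixedRoots H τ hH) ↔ cartanRestrict τ hH x = x := by
  refine ⟨cartanRestrict_eq_self_of_mem_derivedOf hH hinv, fun hx ↦ ?_⟩
  replace hx : x ∈ LinearMap.eqLocus (cartanRestrict τ hH) LinearMap.id := hx
  rw [← span_coroot_eq_eqLocus hH hinv hsplit] at hx
  induction hx using Submodule.span_induction with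
  | mem x hx =>
    obtain ⟨α, hα, hατ, rfl⟩ := hx
    exact coroot_mem_derivedOf hH hα hατ
  | zero => exact zero_mem _
  | add x y _ _ h₁ h₂ => exact add_mem h₁ h₂
  | smul c x _ h => exact SMulMemClass.smul_mem c h

include hsplit in
lemma isCartanSubalgebra_comap_fixed :
    (LieSubalgebra.comap (derivedOf (leviOfFixedRoots H τ hH)).incl
      (fixedLieSubalgebra τ ⊓ H)).IsCartanSubalgebra where
  nilpotent := by
    set D := derivedOf (leviOfFixedRoots H τ hH)
    have : IsLieAbelian (LieSubalgebra.comap D.incl (fixedLieSubalgebra τ ⊓ H)) :=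
      ⟨fun x y ↦ Subtype.ext <| Subtype.ext <| show ⁅x.1.1, y.1.1⁆ = 0 from
        congrArg Subtype.val (trivial_lie_zero H H ⟨x.1.1, x.2.2⟩ ⟨y.1.1, y.2.2⟩)⟩
    infer_instance
  self_normalizing := by
    refine le_antisymm (fun y hy ↦ ?_) (LieSubalgebra.le_normalizer _)
    rw [LieSubalgebra.mem_normalizer_iff] at hy
    have hyH : (y : L) ∈ H := by
      refine LieSubalgebra.IsCartanSubalgebra.self_normalizing (H := H).le <|
        (LieSubalgebra.mem_normalizer_iff _ _).2 ?_
      intro h hh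
      lift h to H using hh
      have h1 : ⁅(y : L), (h + cartanRestrict τ hH h : L)⁆ ∈ H := by
        have hfix : cartanRestrict τ hH (h + cartanRestrict τ hH h) =
            h + cartanRestrict τ hH h := by
          rw [map_add, cartanRestrict_cartanRestrict hH hinv, add_comm]
        refine (hy ⟨(h + cartanRestrict τ hH h : H), ?_⟩ ⟨?_, ?_⟩).2
        · exact (mem_derivedOf_iff hH hinv hsplit).2 hfix
        · exact congrArg Subtype.val hfix
        · exact (h + cartanRestrict τ hH h).2
      have h2 : ⁅(h - cartanRestrict τ hH h : L), (y : L)⁆ = 0 := by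
        refine lie_eq_zero_of_mem_leviOfFixedRoots hH (z := h - cartanRestrict τ hH h) ?_
          (derivedOf_le _ y.2)
        rw [map_sub, cartanRestrict_cartanRestrict hH hinv, neg_sub]
      have h3 : ⁅(y : L), (h : L)⁆ = (2⁻¹ : K) • ⁅(y : L), (h + cartanRestrict τ hH h : L)⁆ := by
        rw [← lie_skew, neg_eq_zero, lie_sub, sub_eq_zero] at h2
        rw [lie_add, ← h2]
        module
      rw [h3]
      exact H.smul_mem _ h1
    have := cartanRestrict_eq_self_of_mem_derivedOf hH hinv (x := ⟨y, hyH⟩) y.2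
    exact ⟨congrArg Subtype.val this, hyH⟩

end levi

end LieAlgebra.IsKilling

theorem split_cartan_involution_fixed_roots_span_and_fixed_torus_is_cartan
    {K : Type*} [Field K] [IsAlgClosed K] [CharZero K]
    {g : Type*} [LieRing g] [LieAlgebra K g] [FiniteDimensional K g]
    [LieAlgebra.IsSemisimple K g]
    (H : LieSubalgebra K g) [H.IsCartanSubalgebra]
    (τ : g ≃ₗ⁅K⁆ g) (hinv : ∀ x : g, τ (τ x) = x)
    (hH : ∀ x ∈ H, τ x ∈ H)
    -- `τ` is a split Cartan involution: `dim g^τ = #Φ / 2`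
    (hsplit : 2 * Module.finrank K ↥(fixedLieSubalgebra τ) =
      Nat.card {w : LieModule.Weight K H g // w.IsNonZero}) :
    -- (a) the τ-fixed roots Φ^τ span t^{*,τ}: no nonzero τ-fixed element of t is killed
    -- by every τ-fixed root
    (∀ x : ↥H, τ (x : g) = (x : g) →
      (∀ w : LieModule.Weight K H g, w.IsNonZero →
        (∀ y : ↥H, w y = w ⟨τ (y : g), hH y y.2⟩) → w x = 0) → (x : g) = 0) ∧
    -- (b) t^τ is a Cartan subalgebra of the derived algebra l^{der} of the Levi l
    (LieSubalgebra.comap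
        (derivedOf (leviOfFixedRoots H τ hH)).incl
        (fixedLieSubalgebra τ ⊓ H)).IsCartanSubalgebra :=
  ⟨fun _ hx h ↦ congrArg Subtype.val <|
    LieAlgebra.IsKilling.eq_zero_of_forall_fixed_root_apply_eq_zero hH hinv hsplit
      (Subtype.ext hx) h,
    LieAlgebra.IsKilling.isCartanSubalgebra_comap_fixed hH hinv hsplit⟩
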